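/- arXiv:1204.5763 — 2 statements merged into one kernel-verified Lean document; each statement's English description precedes it below -/
import Mathlib

section
/- Let V : ℝ² → Matrix (Fin 2) (Fin 2) ℝ be C² with V(x) symmetric for every x, and let θ : ℝ² → ℝ be C². Suppose that I₂ + V(x) is invertible for every x ∈ ℝ² and that the constraint ∇·V = A (I₂ + V) ∇θ holds pointwise on ℝ². Then the structural identity ∇·(∇·V) = − ∇·[ A V (I₂ + V)^{-1} A (∇·V) ] holds pointwise on ℝ², i.e. Σ_j ∂_j (∇·V)_j (x) = − Σ_j ∂_j ( A V (I₂+V)^{-1} A (∇·V) )_j (x) for all x. -/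
open Matrix

/-- The partial derivative in the `i`-th coordinate direction of a scalar
function on `ℝ²`. -/
noncomputable def pd (i : Fin 2) (f : (Fin 2 → ℝ) → ℝ) (x : Fin 2 → ℝ) : ℝ :=
  fderiv ℝ f x (Pi.single i 1)

/-- The divergence of a matrix field: `(∇·M)_j = Σ_i ∂_i M_{ij}`. -/
noncomputable def matDiv (M : (Fin 2 → ℝ) → Matrix (Fin 2) (Fin 2) ℝ)
    (x : Fin 2 → ℝ) : Fin 2 → ℝ :=
  fun j => ∑ i, pd i (fun y => M y i j) x

/-- The constant rotation matrix `A = [[0, -1], [1, 0]]`. -/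
def Arot : Matrix (Fin 2) (Fin 2) ℝ := !![0, -1; 1, 0]

lemma pd_diff {θ : (Fin 2 → ℝ) → ℝ} (hθ : ContDiff ℝ 2 θ) (i : Fin 2) :
    Differentiable ℝ (fun y => pd i θ y) := by
  have h1 : ContDiff ℝ 1 (fderiv ℝ θ) := hθ.fderiv_right (by norm_num)
  have h2 := h1.differentiable (by norm_num)
  unfold pd
  exact h2.clm_apply (differentiable_const _)

lemma pd_comm {θ : (Fin 2 → ℝ) → ℝ} (hθ : ContDiff ℝ 2 θ) (i j : Fin 2) (x : Fin 2 → ℝ) :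
    pd i (fun y => pd j θ y) x = pd j (fun y => pd i θ y) x := by
  have h1 : ContDiff ℝ 1 (fderiv ℝ θ) := hθ.fderiv_right (by norm_num)
  have h2 := h1.differentiable (by norm_num)
  have hs : IsSymmSndFDerivAt ℝ θ x := hθ.contDiffAt.isSymmSndFDerivAt (by simp)
  have key : ∀ k l : Fin 2, pd k (fun y => pd l θ y) x
      = fderiv ℝ (fderiv ℝ θ) x (Pi.single k 1) (Pi.single l 1) := by
    intro k l
    unfold pd
    rw [fderiv_clm_apply (h2 x) (differentiableAt_const _)]
    simp
  rw [key, key]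
  exact hs _ _

/-- If `V` is a `C²` symmetric-matrix field with `I₂ + V` invertible and
`∇·V = A (I₂ + V) ∇θ` pointwise, then
`∇·(∇·V) = - ∇·[A V (I₂ + V)⁻¹ A (∇·V)]` pointwise. -/
theorem div_div_strain_identity
    (V : (Fin 2 → ℝ) → Matrix (Fin 2) (Fin 2) ℝ) (θ : (Fin 2 → ℝ) → ℝ)
    (hV : ∀ i j, ContDiff ℝ 2 fun x => V x i j) (hθ : ContDiff ℝ 2 θ)
    (hsym : ∀ x, (V x)ᵀ = V x)
    (hinv : ∀ x, IsUnit (1 + V x))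
    (hconstraint : ∀ x,
      matDiv V x = (Arot * (1 + V x)).mulVec fun i => pd i θ x) :
    ∀ x, ∑ j, pd j (fun y => matDiv V y j) x
        = -∑ j, pd j
            (fun y =>
              (Arot * V y * (1 + V y)⁻¹ * Arot).mulVec (matDiv V y) j) x := by
  intro x
  have hR : ∀ j, (fun y => (Arot * V y * (1 + V y)⁻¹ * Arot).mulVec (matDiv V y) j)
      = fun y => -((Arot * V y).mulVec (fun i => pd i θ y) j) := by
    intro j
    funext y
    have hdet : IsUnit (1 + V y).det := (Matrix.isUnit_iff_isUnit_det _).1 (hinv y)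
    have hA : Arot * Arot = -1 := by
      ext a b
      fin_cases a <;> fin_cases b <;> simp [Arot]
    have hm : Arot * V y * (1 + V y)⁻¹ * Arot * (Arot * (1 + V y)) = -(Arot * V y) := by
      calc _ = Arot * V y * (1 + V y)⁻¹ * (Arot * Arot) * (1 + V y) := by
            simp only [Matrix.mul_assoc]
        _ = -(Arot * V y * ((1 + V y)⁻¹ * (1 + V y))) := by
            rw [hA]; simp [Matrix.mul_assoc]
        _ = _ := by rw [Matrix.nonsing_inv_mul _ hdet, Matrix.mul_one]
    rw [hconstraint y, Matrix.mulVec_mulVec, hm, Matrix.neg_mulVec]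
    rfl
  have hL : ∀ j, (fun y => matDiv V y j) = fun y => Arot.mulVec (fun i => pd i θ y) j
      + (Arot * V y).mulVec (fun i => pd i θ y) j := by
    intro j
    funext y
    rw [hconstraint y, Matrix.mul_add, Matrix.add_mulVec, Matrix.mul_one]
    rfl
  have hd := fun i => pd_diff hθ i
  have hVd : ∀ i j, Differentiable ℝ fun x => V x i j :=
    fun i j => (hV i j).differentiable (by norm_num)
  have d1 : ∀ j, Differentiable ℝ (fun y => Arot.mulVec (fun i => pd i θ y) j) := by
    intro j
    simp only [Matrix.mulVec, dotProduct, Fin.sum_univ_two]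
    exact ((hd 0).const_mul _).add ((hd 1).const_mul _)
  have d2 : ∀ j, Differentiable ℝ (fun y => (Arot * V y).mulVec (fun i => pd i θ y) j) := by
    intro j
    simp only [Matrix.mulVec, dotProduct, Fin.sum_univ_two, Matrix.mul_apply]
    exact ((((hVd 0 0).const_mul _).add ((hVd 1 0).const_mul _)).mul (hd 0)).add
      ((((hVd 0 1).const_mul _).add ((hVd 1 1).const_mul _)).mul (hd 1))
  have hsum : ∀ j, pd j (fun y => matDiv V y j) x
      = pd j (fun y => Arot.mulVec (fun i => pd i θ y) j) x
        + pd j (fun y => (Arot * V y).mulVec (fun i => pd i θ y) j) x := by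
    intro j
    rw [hL j]
    exact congrArg (fun L => L (Pi.single j 1)) (fderiv_fun_add (d1 j x) (d2 j x))
  have hneg : ∀ (j : Fin 2) (f : (Fin 2 → ℝ) → ℝ), pd j (fun y => -(f y)) x = -pd j f x := by
    intro j f
    unfold pd
    rw [fderiv_fun_neg]
    rfl
  have e0 : (fun y => Arot.mulVec (fun i => pd i θ y) 0) = fun y => -(pd 1 θ y) := by
    funext y
    simp [Arot, Matrix.mulVec, dotProduct, Fin.sum_univ_two]
  have e1 : (fun y => Arot.mulVec (fun i => pd i θ y) 1) = fun y => pd 0 θ y := by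
    funext y
    simp [Arot, Matrix.mulVec, dotProduct, Fin.sum_univ_two]
  have hc := pd_comm hθ 0 1 x
  rw [Fin.sum_univ_two, Fin.sum_univ_two, hsum, hsum, hR, hR, hneg, hneg, e0, e1, hneg, hc]
  ring
end

section
/- Let u : ℝ × ℝ² → ℝ², p : ℝ × ℝ² → ℝ, V : ℝ × ℝ² → Matrix (Fin 2) (Fin 2) ℝ and θ : ℝ × ℝ² → ℝ be C³, with V(t,x) symmetric and I₂ + V(t,x) invertible for all (t,x). Assume that pointwise: (i) ∇·u = 0 (spatial divergence), (ii) the constraint ∇·V = A (I₂ + V) ∇θ holds (spatial operators), and (iii) the momentum equation ∂_t u + (u·∇)u + ∇p = Δu + ∇·(V Vᵀ) + 2 ∇·V holds. Then the pressure satisfies the Poisson equation Δp = − Σ_{i,j} ∂_i ∂_j (u_i u_j) + Σ_{i,j} ∂_i ∂_j (V Vᵀ)_{ij} − 2 ∇·[ A V (I₂ + V)^{-1} A (∇·V) ] pointwise. -/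
open Matrix

/-- The spatial partial derivative in the `i`-th coordinate direction of a
scalar function of time and space. -/
noncomputable def pds (i : Fin 2) (f : ℝ × (Fin 2 → ℝ) → ℝ) (t : ℝ)
    (x : Fin 2 → ℝ) : ℝ :=
  fderiv ℝ (fun y => f (t, y)) x (Pi.single i 1)

/-- The spatial divergence of a time-dependent matrix field:
`(∇·M)_j = Σ_i ∂_i M_{ij}`. -/
noncomputable def matDivs (M : ℝ × (Fin 2 → ℝ) → Matrix (Fin 2) (Fin 2) ℝ)
    (t : ℝ) (x : Fin 2 → ℝ) : Fin 2 → ℝ :=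
  fun j => ∑ i, pds i (fun q => M q i j) t x

abbrev EE := ℝ × (Fin 2 → ℝ)

noncomputable def DD (v : EE) (f : EE → ℝ) : EE → ℝ := fun q => fderiv ℝ f q v

def ee (i : Fin 2) : EE := (0, Pi.single i 1)

lemma pds_eq (i : Fin 2) {f : EE → ℝ} (hf : ContDiff ℝ 1 f) (t : ℝ) (x : Fin 2 → ℝ) :
    pds i f t x = DD (ee i) f (t, x) := by
  have h1 : HasFDerivAt f (fderiv ℝ f (t, x)) (t, x) :=
    (hf.differentiable (by norm_num) (t, x)).hasFDerivAt
  have h2 : HasFDerivAt (fun y : Fin 2 → ℝ => (t, y))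
      (ContinuousLinearMap.inr ℝ ℝ (Fin 2 → ℝ)) x := hasFDerivAt_prodMk_right t x
  have h3 := h1.comp x h2
  unfold pds DD ee
  have h4 : fderiv ℝ (fun y => f (t, y)) x = _ := h3.fderiv
  rw [h4]
  simp

lemma dt_eq {f : EE → ℝ} (hf : ContDiff ℝ 1 f) (t : ℝ) (x : Fin 2 → ℝ) :
    deriv (fun s => f (s, x)) t = DD (1, 0) f (t, x) := by
  have h1 : HasFDerivAt f (fderiv ℝ f (t, x)) (t, x) :=
    (hf.differentiable (by norm_num) (t, x)).hasFDerivAt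
  have h2 : HasDerivAt (fun s : ℝ => (s, x)) ((1 : ℝ), (0 : Fin 2 → ℝ)) t :=
    (hasDerivAt_id t).prodMk (hasDerivAt_const t x)
  exact (h1.comp_hasDerivAt t h2).deriv

lemma DD_cd (v : EE) {f : EE → ℝ} {m n : WithTop ℕ∞} (hf : ContDiff ℝ n f) (h : m + 1 ≤ n) :
    ContDiff ℝ m (DD v f) :=
  (hf.fderiv_right h).clm_apply contDiff_const

lemma DD_comm (v w : EE) {f : EE → ℝ} (hf : ContDiff ℝ 2 f) (q : EE) :
    DD v (DD w f) q = DD w (DD v f) q := by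
  have hs : IsSymmSndFDerivAt ℝ f q := hf.contDiffAt.isSymmSndFDerivAt (by simp)
  have hd : DifferentiableAt ℝ (fderiv ℝ f) q :=
    (hf.fderiv_right (m := 1) (by norm_num)).differentiable (by norm_num) q
  have key : ∀ a b : EE, DD a (DD b f) q = fderiv ℝ (fderiv ℝ f) q a b := by
    intro a b
    have := (hd.hasFDerivAt.clm_apply (hasFDerivAt_const b q)).fderiv
    unfold DD
    rw [this]
    simp
  rw [key, key]
  exact hs v w

lemma DD_add (v : EE) {f g : EE → ℝ} (hf : ContDiff ℝ 1 f) (hg : ContDiff ℝ 1 g) (q : EE) :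
    DD v (fun r => f r + g r) q = DD v f q + DD v g q := by
  unfold DD
  rw [fderiv_fun_add (hf.differentiable (by norm_num) q) (hg.differentiable (by norm_num) q)]
  simp

lemma DD_neg (v : EE) {f : EE → ℝ} (q : EE) :
    DD v (fun r => - f r) q = - DD v f q := by
  unfold DD
  rw [fderiv_fun_neg]
  simp

lemma DD_mul (v : EE) {f g : EE → ℝ} (hf : ContDiff ℝ 1 f) (hg : ContDiff ℝ 1 g) (q : EE) :
    DD v (fun r => f r * g r) q = f q * DD v g q + g q * DD v f q := by
  unfold DD
  rw [fderiv_fun_mul (hf.differentiable (by norm_num) q) (hg.differentiable (by norm_num) q)]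
  simp

lemma DD_zero (v : EE) (q : EE) : DD v (fun _ => (0 : ℝ)) q = 0 := by
  simp [DD]

lemma DD_two (v : EE) {f : EE → ℝ} (hf : ContDiff ℝ 1 f) (q : EE) :
    DD v (fun r => 2 * f r) q = 2 * DD v f q := by
  rw [DD_mul v contDiff_const hf]
  simp [DD]

lemma pds2_eq (i j : Fin 2) {f : EE → ℝ} (hf : ContDiff ℝ 2 f) (t : ℝ) (x : Fin 2 → ℝ) :
    pds i (fun q => pds j f q.1 q.2) t x = DD (ee i) (DD (ee j) f) (t, x) := by
  have h : (fun q : EE => pds j f q.1 q.2) = DD (ee j) f := by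
    funext q
    exact pds_eq j (hf.of_le (by norm_num)) q.1 q.2
  rw [h, pds_eq i (DD_cd _ hf (by norm_num))]

/-- For `C³` fields satisfying `∇·u = 0`, the constraint
`∇·V = A (I₂ + V) ∇θ`, and the momentum equation
`∂ₜu + (u·∇)u + ∇p = Δu + ∇·(V Vᵀ) + 2 ∇·V`, the pressure satisfies
`Δp = - Σ_{i,j} ∂_i∂_j (u_i u_j) + Σ_{i,j} ∂_i∂_j (V Vᵀ)_{ij}
      - 2 ∇·[A V (I₂ + V)⁻¹ A (∇·V)]` pointwise. -/
theorem pressure_poisson_equation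
    (u : ℝ × (Fin 2 → ℝ) → (Fin 2 → ℝ)) (p : ℝ × (Fin 2 → ℝ) → ℝ)
    (V : ℝ × (Fin 2 → ℝ) → Matrix (Fin 2) (Fin 2) ℝ)
    (θ : ℝ × (Fin 2 → ℝ) → ℝ)
    (hu : ∀ j, ContDiff ℝ 3 fun q => u q j) (hp : ContDiff ℝ 3 p)
    (hV : ∀ i j, ContDiff ℝ 3 fun q => V q i j) (hθ : ContDiff ℝ 3 θ)
    (hsym : ∀ t x, (V (t, x))ᵀ = V (t, x))
    (hinv : ∀ t x, IsUnit (1 + V (t, x)))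
    (hdiv : ∀ t x, ∑ i, pds i (fun q => u q i) t x = 0)
    (hconstraint : ∀ t x,
      matDivs V t x = (Arot * (1 + V (t, x))).mulVec fun i => pds i θ t x)
    (hmom : ∀ t x (j : Fin 2),
      deriv (fun s => u (s, x) j) t
          + (∑ k, u (t, x) k * pds k (fun q => u q j) t x) + pds j p t x
        = (∑ i, pds i (fun q => pds i (fun r => u r j) q.1 q.2) t x)
            + matDivs (fun q => V q * (V q)ᵀ) t x j + 2 * matDivs V t x j) :
    ∀ t x, ∑ i, pds i (fun q => pds i p q.1 q.2) t x
        = -(∑ i, ∑ j, pds i (fun q => pds j (fun r => u r i * u r j) q.1 q.2) t x)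
            + (∑ i, ∑ j,
                pds i (fun q => pds j (fun r => (V r * (V r)ᵀ) i j) q.1 q.2) t x)
            - 2 * ∑ j, pds j
                (fun q => (Arot * V q * (1 + V q)⁻¹ * Arot).mulVec
                  (matDivs V q.1 q.2) j) t x := by
  have hW : ∀ i j, ContDiff ℝ 3 fun q => (V q * (V q)ᵀ) i j := by
    intro i j
    simp only [Matrix.mul_apply, Matrix.transpose_apply]
    exact ContDiff.sum fun k _ => (hV i k).mul (hV j k)
  have l13 : (1 : WithTop ℕ∞) ≤ 3 := by norm_num
  have l23 : (2 : WithTop ℕ∞) ≤ 3 := by norm_num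
  have l12 : (1 : WithTop ℕ∞) ≤ 2 := by norm_num
  have a3 : (2 : WithTop ℕ∞) + 1 ≤ 3 := by norm_num
  have a2 : (1 : WithTop ℕ∞) + 1 ≤ 2 := by norm_num
  -- last term
  have hG : ∀ j : Fin 2, (fun q : EE => (Arot * V q * (1 + V q)⁻¹ * Arot).mulVec
      (matDivs V q.1 q.2) j) = fun q => -(matDivs V q.1 q.2 j) +
        Arot.mulVec (fun i => pds i θ q.1 q.2) j := by
    intro j
    funext q
    have hc := hconstraint q.1 q.2
    have hi : IsUnit (1 + V q).det := (Matrix.isUnit_iff_isUnit_det _).1 (hinv q.1 q.2)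
    have hA : Arot * Arot = -1 := by
      ext i j; fin_cases i <;> fin_cases j <;> simp [Arot]
    have e1 : Arot * V q * (1 + V q)⁻¹ * Arot * (Arot * (1 + V q)) = -(Arot * V q) := by
      calc _ = Arot * V q * (1 + V q)⁻¹ * (Arot * Arot) * (1 + V q) := by noncomm_ring
        _ = -(Arot * V q * ((1 + V q)⁻¹ * (1 + V q))) := by rw [hA]; noncomm_ring
        _ = _ := by rw [Matrix.nonsing_inv_mul _ hi, Matrix.mul_one]
    have hc' : matDivs V q.1 q.2 = (Arot * (1 + V q)).mulVec fun i => pds i θ q.1 q.2 := hc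
    rw [hc', Matrix.mulVec_mulVec, e1, Matrix.mul_add, Matrix.mul_one, Matrix.add_mulVec,
      Matrix.neg_mulVec]
    simp
  have hMV : ∀ (M : EE → Matrix (Fin 2) (Fin 2) ℝ), (∀ i j, ContDiff ℝ 3 fun q => M q i j) →
      ∀ t x j, matDivs M t x j = DD (ee 0) (fun q => M q 0 j) (t, x)
        + DD (ee 1) (fun q => M q 1 j) (t, x) := by
    intro M hM t x j
    unfold matDivs
    rw [Fin.sum_univ_two, pds_eq 0 ((hM _ _).of_le l13), pds_eq 1 ((hM _ _).of_le l13)]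
  -- regularity
  have c1 : ∀ {f : EE → ℝ}, ContDiff ℝ 3 f → ContDiff ℝ 1 f := fun h => h.of_le l13
  have c2 : ∀ {f : EE → ℝ}, ContDiff ℝ 3 f → ContDiff ℝ 2 f := fun h => h.of_le l23
  have d2 : ∀ v {f : EE → ℝ}, ContDiff ℝ 3 f → ContDiff ℝ 2 (DD v f) :=
    fun v f h => DD_cd v h a3
  have d1 : ∀ v {f : EE → ℝ}, ContDiff ℝ 3 f → ContDiff ℝ 1 (DD v f) :=
    fun v f h => (d2 v h).of_le l12
  have dd1 : ∀ v w {f : EE → ℝ}, ContDiff ℝ 3 f → ContDiff ℝ 1 (DD v (DD w f)) :=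
    fun v w f h => DD_cd v (d2 w h) a2
  have hG' : ∀ t x (j : Fin 2), pds j (fun q : EE => (Arot * V q * (1 + V q)⁻¹ * Arot).mulVec
      (matDivs V q.1 q.2) j) t x = -(DD (ee j) (DD (ee 0) (fun q => V q 0 j)) (t, x)
        + DD (ee j) (DD (ee 1) (fun q => V q 1 j)) (t, x)) +
        (Arot j 0 * DD (ee j) (DD (ee 0) θ) (t, x) + Arot j 1 * DD (ee j) (DD (ee 1) θ) (t, x)) := by
    intro t x j
    have : (fun q : EE => (Arot * V q * (1 + V q)⁻¹ * Arot).mulVec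
      (matDivs V q.1 q.2) j) = fun q => -(DD (ee 0) (fun q => V q 0 j) q
        + DD (ee 1) (fun q => V q 1 j) q) +
        (Arot j 0 * DD (ee 0) θ q + Arot j 1 * DD (ee 1) θ q) := by
      rw [hG]
      funext q
      rw [hMV V hV]
      simp only [Matrix.mulVec, dotProduct, Fin.sum_univ_two, pds_eq _ (c1 hθ)]
    have b0 := d1 (ee 0) (hV 0 j)
    have b1 := d1 (ee 1) (hV 1 j)
    have b2 := d1 (ee 0) hθ
    have b3 := d1 (ee 1) hθ
    have k : ∀ c : ℝ, ContDiff ℝ 1 (fun _ : EE => c) := fun c => contDiff_const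
    have kz : ∀ (c : ℝ) v q, DD v (fun _ : EE => c) q = 0 := by intro c v q; simp [DD]
    rw [this, pds_eq j (((b0.add b1).neg).add (((k _).mul b2).add ((k _).mul b3))),
      DD_add _ (b0.add b1).neg (((k _).mul b2).add ((k _).mul b3)), DD_neg, DD_add _ b0 b1,
      DD_add _ ((k _).mul b2) ((k _).mul b3), DD_mul _ (k _) b2, DD_mul _ (k _) b3, kz, kz]
    ring
  -- divergence
  have hd : (fun q => DD (ee 0) (fun q => u q 0) q + DD (ee 1) (fun q => u q 1) q)
      = fun _ => (0 : ℝ) := by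
    funext q
    have := hdiv q.1 q.2
    rwa [Fin.sum_univ_two, pds_eq 0 (c1 (hu _)), pds_eq 1 (c1 (hu _))] at this
  have hdv : ∀ v q, DD v (DD (ee 0) (fun q => u q 0)) q
      + DD v (DD (ee 1) (fun q => u q 1)) q = 0 := by
    intro v q
    rw [← DD_add _ (d1 _ (hu 0)) (d1 _ (hu 1)), hd, DD_zero]
  have hdvw : ∀ v w q, DD v (DD w (DD (ee 0) (fun q => u q 0))) q
      + DD v (DD w (DD (ee 1) (fun q => u q 1))) q = 0 := by
    intro v w q
    rw [← DD_add _ (dd1 _ _ (hu 0)) (dd1 _ _ (hu 1)), funext (hdv w), DD_zero]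
  -- momentum
  have hm : ∀ j : Fin 2, (fun q => (DD (1, 0) (fun r => u r j) q
      + (u q 0 * DD (ee 0) (fun r => u r j) q + u q 1 * DD (ee 1) (fun r => u r j) q))
      + DD (ee j) p q)
      = fun q => ((DD (ee 0) (DD (ee 0) (fun r => u r j)) q
        + DD (ee 1) (DD (ee 1) (fun r => u r j)) q)
        + (DD (ee 0) (fun r => (V r * (V r)ᵀ) 0 j) q + DD (ee 1) (fun r => (V r * (V r)ᵀ) 1 j) q))
        + 2 * (DD (ee 0) (fun r => V r 0 j) q + DD (ee 1) (fun r => V r 1 j) q) := by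
    intro j
    funext q
    have := hmom q.1 q.2 j
    rw [dt_eq (c1 (hu j)), hMV _ hW, hMV _ hV] at this
    simp only [Fin.sum_univ_two] at this
    rw [pds2_eq _ _ (c2 (hu j)), pds2_eq _ _ (c2 (hu j))] at this
    simpa only [pds_eq _ (c1 (hu j)),
      pds_eq _ (c1 hp)] using this
  intro t x
  have hmd : ∀ j : Fin 2, _ := fun j => congrArg (fun f => DD (ee j) f (t, x)) (hm j)
  have hmd' : ∀ j : Fin 2, (DD (ee j) (DD (1, 0) (fun r => u r j)) (t, x)
      + ((u (t, x) 0 * DD (ee j) (DD (ee 0) (fun r => u r j)) (t, x)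
          + DD (ee 0) (fun r => u r j) (t, x) * DD (ee j) (fun r => u r 0) (t, x))
        + (u (t, x) 1 * DD (ee j) (DD (ee 1) (fun r => u r j)) (t, x)
          + DD (ee 1) (fun r => u r j) (t, x) * DD (ee j) (fun r => u r 1) (t, x))))
      + DD (ee j) (DD (ee j) p) (t, x)
      = ((DD (ee j) (DD (ee 0) (DD (ee 0) (fun r => u r j))) (t, x)
        + DD (ee j) (DD (ee 1) (DD (ee 1) (fun r => u r j))) (t, x))
        + (DD (ee j) (DD (ee 0) (fun r => (V r * (V r)ᵀ) 0 j)) (t, x)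
          + DD (ee j) (DD (ee 1) (fun r => (V r * (V r)ᵀ) 1 j)) (t, x)))
        + 2 * (DD (ee j) (DD (ee 0) (fun r => V r 0 j)) (t, x)
          + DD (ee j) (DD (ee 1) (fun r => V r 1 j)) (t, x)) := by
    intro j
    have h := hmd j
    have x1 := d1 (1, 0) (hu j)
    have x2 := d1 (ee 0) (hu j)
    have x3 := d1 (ee 1) (hu j)
    have y0 := c1 (hu 0)
    have y1 := c1 (hu 1)
    have x4 := d1 (ee j) hp
    have x5 := dd1 (ee 0) (ee 0) (hu j)
    have x6 := dd1 (ee 1) (ee 1) (hu j)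
    have x7 := d1 (ee 0) (hW 0 j)
    have x8 := d1 (ee 1) (hW 1 j)
    have x9 := d1 (ee 0) (hV 0 j)
    have x10 := d1 (ee 1) (hV 1 j)
    beta_reduce at h
    rw [DD_add _ (x1.add ((y0.mul x2).add (y1.mul x3))) x4,
      DD_add _ x1 ((y0.mul x2).add (y1.mul x3)), DD_add _ (y0.mul x2) (y1.mul x3),
      DD_mul _ y0 x2, DD_mul _ y1 x3,
      DD_add _ ((x5.add x6).add (x7.add x8)) (contDiff_const.mul (x9.add x10)),
      DD_add _ (x5.add x6) (x7.add x8), DD_add _ x5 x6, DD_add _ x7 x8,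
      DD_two _ (x9.add x10), DD_add _ x9 x10] at h
    exact h
  have huu : ∀ i j : Fin 2, DD (ee i) (DD (ee j) (fun r => u r i * u r j)) (t, x)
      = (u (t, x) i * DD (ee i) (DD (ee j) (fun r => u r j)) (t, x)
        + DD (ee j) (fun r => u r j) (t, x) * DD (ee i) (fun r => u r i) (t, x))
        + (u (t, x) j * DD (ee i) (DD (ee j) (fun r => u r i)) (t, x)
        + DD (ee j) (fun r => u r i) (t, x) * DD (ee i) (fun r => u r j) (t, x)) := by
    intro i j
    rw [funext (DD_mul (ee j) (c1 (hu i)) (c1 (hu j))),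
      DD_add _ ((c1 (hu i)).mul (d1 _ (hu j))) ((c1 (hu j)).mul (d1 _ (hu i))),
      DD_mul _ (c1 (hu i)) (d1 _ (hu j)), DD_mul _ (c1 (hu j)) (d1 _ (hu i))]
  have comm3 : ∀ (v w : EE) {f : EE → ℝ}, ContDiff ℝ 3 f →
      DD v (DD w (DD w f)) (t, x) = DD w (DD w (DD v f)) (t, x) := by
    intro v w f hf
    rw [DD_comm v w (d2 w hf), funext (DD_comm v w (c2 hf))]
  simp only [hG']
  simp only [Fin.sum_univ_two, pds2_eq _ _ (c2 hp), pds2_eq _ _ (c2 (hW _ _)),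
    pds2_eq _ _ (c2 ((hu _).mul (hu _))), huu]
  have m0 := hmd' 0
  have m1 := hmd' 1
  have A00 : Arot 0 0 = 0 := by simp [Arot]
  have A01 : Arot 0 1 = -1 := by simp [Arot]
  have A10 : Arot 1 0 = 1 := by simp [Arot]
  have A11 : Arot 1 1 = 0 := by simp [Arot]
  rw [A00, A01, A10, A11]
  have t1 := hdv (1, 0) (t, x)
  rw [DD_comm _ (ee 0) (c2 (hu 0)), DD_comm _ (ee 1) (c2 (hu 1))] at t1
  have t2 := hdvw (ee 0) (ee 0) (t, x)
  have t3 := hdvw (ee 1) (ee 1) (t, x)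
  rw [comm3 (ee 0) (ee 1) (hu 0)] at m0
  rw [comm3 (ee 1) (ee 0) (hu 1)] at m1
  have t4 := hdv (ee 0) (t, x)
  have t5 := hdv (ee 1) (t, x)
  have t6 : DD (ee 0) (fun q => u q 0) (t, x) + DD (ee 1) (fun q => u q 1) (t, x) = 0 :=
    congrFun hd (t, x)
  have s1 := DD_comm (ee 1) (ee 0) (c2 hθ) (t, x)
  have s2 := DD_comm (ee 1) (ee 0) (c2 (hu 0)) (t, x)
  have s3 := DD_comm (ee 1) (ee 0) (c2 (hu 1)) (t, x)
  have s4 := DD_comm (ee 1) (ee 0) (c2 (hW 0 1)) (t, x)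
  have s5 := DD_comm (ee 1) (ee 0) (c2 (hW 1 0)) (t, x)
  rw [s2] at t5
  rw [s1, s2, s3]
  rw [s4] at m1
  rw [s5]
  rw [s3] at m1
  linear_combination m0 + m1 - t1 + t2 + t3 + u (t, x) 0 * t4 + u (t, x) 1 * t5 + t6 * (DD (ee 0) (fun q => u q 0) (t, x) + DD (ee 1) (fun q => u q 1) (t, x))
end
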